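/- arXiv:math/0408107 — 7 statements merged into one kernel-verified Lean document; each statement's English description precedes it below -/
import Mathlib

section
/- A prime p other than 3 can be represented as p = a² + ab + b² with a and b nonnegative integers if and only if p ≡ 1 (mod 6); moreover, when such a representation exists, it is unique up to the order of a and b. -/
/-- **Thue's lemma**, with coordinates bounded by the square root of the prime. -/
theorem exists_small_intCast_eq_mul (p : ℕ) (hp : p.Prime) (x : ZMod p) :
    ∃ a b : ℤ, (a ≠ 0 ∨ b ≠ 0) ∧ a ^ 2 < p ∧ b ^ 2 < p ∧ (a : ZMod p) = x * b := by
  have := Fact.mk hp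
  let k := Nat.sqrt p
  let f : Fin (k + 1) × Fin (k + 1) → ZMod p := fun u => (u.1 : ℕ) - x * (u.2 : ℕ)
  have hcard : Fintype.card (ZMod p) < Fintype.card (Fin (k + 1) × Fin (k + 1)) := by
    simpa [ZMod.card] using Nat.lt_succ_sqrt p
  obtain ⟨⟨u₁, u₂⟩, ⟨v₁, v₂⟩, hne, hf⟩ := Fintype.exists_ne_map_eq_of_card_lt f hcard
  have hk : k ^ 2 < p := by
    refine lt_of_le_of_ne (Nat.sqrt_le' p) fun h => ?_
    exact hp.prime.irreducible.not_isSquare ⟨k, by rw [← h, sq]⟩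
  have small (s t : Fin (k + 1)) : ((s : ℤ) - t) ^ 2 < p := by
    have hs := s.is_le
    have ht := t.is_le
    have : ((s : ℤ) - t) ^ 2 ≤ (k : ℤ) ^ 2 := sq_le_sq' (by omega) (by omega)
    exact this.trans_lt (mod_cast hk)
  refine ⟨(u₁ : ℤ) - v₁, (u₂ : ℤ) - v₂, ?_, small _ _, small _ _, ?_⟩
  · by_contra! h
    apply hne
    ext
    · simp only; omega
    · simp only; omega
  · simp only [f] at hf
    push_cast
    linear_combination hf

theorem exists_sq_add_self_add_one_eq_zero (p : ℕ) (hp : p.Prime) (h : p % 3 = 1) :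
    ∃ x : ZMod p, x ^ 2 + x + 1 = 0 := by
  have := Fact.mk hp
  have hdvd : 3 ∣ Nat.card (ZMod p)ˣ := by
    rw [Nat.card_eq_fintype_card, ZMod.card_units]
    omega
  obtain ⟨u, hu⟩ := exists_prime_orderOf_dvd_card' 3 hdvd
  have hu1 : u ≠ 1 := by
    rintro rfl
    simp at hu
  have hu3 : (u : ZMod p) ^ 3 = 1 := by
    rw [← Units.val_pow_eq_pow_val, ← hu, pow_orderOf_eq_one, Units.val_one]
  refine ⟨u, (mul_eq_zero.mp (?_ : ((u : ZMod p) - 1) * _ = 0)).resolve_left ?_⟩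
  · linear_combination hu3
  · simpa [sub_eq_zero] using hu1

theorem exists_nat_eq_sq_add_mul_add_sq {n a b : ℤ} (h : n = a ^ 2 + a * b + b ^ 2) :
    ∃ c d : ℕ, n = (c : ℤ) ^ 2 + c * d + (d : ℤ) ^ 2 := by
  suffices H : ∃ c d : ℤ, 0 ≤ c ∧ 0 ≤ d ∧ n = c ^ 2 + c * d + d ^ 2 by
    obtain ⟨c, d, hc, hd, hn⟩ := H
    lift c to ℕ using hc
    lift d to ℕ using hd
    exact ⟨c, d, hn⟩
  rcases le_total 0 a with ha | ha <;> rcases le_total 0 b with hb | hb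
  · exact ⟨a, b, ha, hb, h⟩
  · rcases le_total 0 (a + b) with hab | hab
    · exact ⟨a + b, -b, hab, by omega, by rw [h]; ring⟩
    · exact ⟨-(a + b), a, by omega, ha, by rw [h]; ring⟩
  · rcases le_total 0 (a + b) with hab | hab
    · exact ⟨a + b, -a, hab, by omega, by rw [h]; ring⟩
    · exact ⟨-(a + b), b, by omega, hb, by rw [h]; ring⟩
  · exact ⟨-a, -b, by omega, by omega, by rw [h]; ring⟩

theorem Nat.Prime.exists_eq_sq_add_mul_add_sq {p : ℕ} (hp : p.Prime) (h : p % 6 = 1) :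
    ∃ a b : ℕ, p = a ^ 2 + a * b + b ^ 2 := by
  obtain ⟨x, hx⟩ := exists_sq_add_self_add_one_eq_zero p hp (by omega)
  obtain ⟨a, b, hne, ha, hb, hab⟩ := exists_small_intCast_eq_mul p hp x
  obtain ⟨m, hm⟩ : (p : ℤ) ∣ a ^ 2 + a * b + b ^ 2 := by
    rw [← ZMod.intCast_zmod_eq_zero_iff_dvd]
    push_cast
    rw [hab]
    linear_combination (b : ZMod p) ^ 2 * hx
  have hp0 : (0 : ℤ) < p := mod_cast hp.pos
  have hpos : 0 < a ^ 2 + a * b + b ^ 2 := by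
    rcases hne with h0 | h0
    · nlinarith [sq_nonneg (a + 2 * b), sq_pos_of_ne_zero h0]
    · nlinarith [sq_nonneg (2 * a + b), sq_pos_of_ne_zero h0]
  have hm0 : 0 < m := by nlinarith
  have hm3 : m < 3 := by nlinarith [sq_nonneg (a - b)]
  have hm2 : m ≠ 2 := by
    rintro rfl
    rcases Int.even_or_odd' a with ⟨s, rfl | rfl⟩ <;>
      rcases Int.even_or_odd' b with ⟨t, rfl | rfl⟩ <;> ring_nf at hm <;> omega
  obtain rfl : m = 1 := by omega
  obtain ⟨c, d, hcd⟩ := exists_nat_eq_sq_add_mul_add_sq (n := p) (a := a) (b := b) (by linarith)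
  exact ⟨c, d, mod_cast hcd⟩

theorem Nat.Prime.mod_six_eq_one_of_eq_sq_add_mul_add_sq {p a b : ℕ} (hp : p.Prime)
    (hp3 : p ≠ 3) (h : p = a ^ 2 + a * b + b ^ 2) : p % 6 = 1 := by
  have h3 : p % 3 = 0 ∨ p % 3 = 1 := by
    have ha : a % 3 = 0 ∨ a % 3 = 1 ∨ a % 3 = 2 := by omega
    have hb : b % 3 = 0 ∨ b % 3 = 1 ∨ b % 3 = 2 := by omega
    rw [h]
    rcases ha with ha | ha | ha <;> rcases hb with hb | hb | hb <;>
      simp [pow_two, Nat.add_mod, Nat.mul_mod, ha, hb]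
  have h30 : p % 3 ≠ 0 := fun h0 =>
    hp3 ((Nat.prime_dvd_prime_iff_eq Nat.prime_three hp).mp (Nat.dvd_of_mod_eq_zero h0)).symm
  rcases hp.eq_two_or_odd with h2 | h2 <;> omega

theorem Nat.Prime.pos_of_eq_sq_add_mul_add_sq {p a b : ℕ} (hp : p.Prime)
    (h : p = a ^ 2 + a * b + b ^ 2) : 0 < a ∧ 0 < b := by
  constructor <;> refine Nat.pos_of_ne_zero ?_ <;> rintro rfl
  · exact hp.prime.irreducible.not_isSquare ⟨b, by rw [h]; ring⟩
  · exact hp.prime.irreducible.not_isSquare ⟨a, by rw [h]; ring⟩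

theorem Nat.Prime.sq_add_mul_add_sq_unique {p a b c d : ℕ} (hp : p.Prime) (hp3 : p ≠ 3)
    (hba : b ≤ a) (hdc : d ≤ c) (h₁ : p = a ^ 2 + a * b + b ^ 2)
    (h₂ : p = c ^ 2 + c * d + d ^ 2) : a = c ∧ b = d := by
  obtain ⟨ha, hb⟩ := hp.pos_of_eq_sq_add_mul_add_sq h₁
  obtain ⟨hc, hd⟩ := hp.pos_of_eq_sq_add_mul_add_sq h₂
  have hne : b ≠ a := by
    rintro rfl
    have : 3 ∣ p := ⟨b ^ 2, by rw [h₁]; ring⟩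
    exact hp3 ((Nat.prime_dvd_prime_iff_eq Nat.prime_three hp).mp this).symm
  have hlt : b < a := lt_of_le_of_ne hba hne
  zify at h₁ h₂ ha hb hc hd hlt hdc
  have hp0 : (0 : ℤ) < p := mod_cast hp.pos
  have hac : (0 : ℤ) < a * c := by positivity
  have hbc : (0 : ℤ) < b * c := by positivity
  have hbd : (0 : ℤ) < b * d := by positivity
  have had : (0 : ℤ) < a * d := by positivity
  have hdvd : (p : ℤ) ∣ ((a : ℤ) * d - b * c) * (a * d + b * c + b * d) :=
    ⟨d ^ 2 - b ^ 2, by linear_combination (-(d : ℤ) ^ 2) * h₁ + (b : ℤ) ^ 2 * h₂⟩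
  have hmul : (p : ℤ) ^ 2 =
      ((a : ℤ) ^ 2 + a * b + b ^ 2) * ((c : ℤ) ^ 2 + c * d + d ^ 2) := by
    rw [← h₁, ← h₂, sq]
  rcases (Nat.prime_iff_prime_int.mp hp).dvd_or_dvd hdvd with hW | hV
  · have hW0 : (a : ℤ) * d - b * c = 0 := by
      apply Int.eq_zero_of_abs_lt_dvd hW
      apply abs_lt_of_sq_lt_sq _ hp0.le
      nlinarith [mul_pos hac hac, mul_pos hac hbd, mul_pos hac had, mul_pos hac hbc,
        mul_pos hbd had, mul_pos hbd hbc, mul_pos had hbc, mul_pos hbd hbd]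
    have hsq : (a : ℤ) ^ 2 * p = c ^ 2 * p := by
      linear_combination (a : ℤ) ^ 2 * h₂ - (c : ℤ) ^ 2 * h₁ + (a * c + a * d + b * c) * hW0
    have hac' : (a : ℤ) = c :=
      (sq_eq_sq₀ ha.le hc.le).mp (mul_right_cancel₀ hp0.ne' hsq)
    refine ⟨mod_cast hac', ?_⟩
    have : (a : ℤ) * d = a * b := by rw [← hac'] at hW0; linarith
    exact_mod_cast (mul_left_cancel₀ ha.ne' this).symm
  · have hle : (p : ℤ) ≤ a * d + b * c + b * d := Int.le_of_dvd (by positivity) hV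
    have hU : (0 : ℤ) < a * c - b * d := by nlinarith
    have : (p : ℤ) ^ 2 = ((a : ℤ) * c - b * d) ^ 2
        + (a * c - b * d) * (a * d + b * c + b * d) + (a * d + b * c + b * d) ^ 2 := by
      rw [hmul]; ring
    nlinarith [pow_le_pow_left₀ hp0.le hle 2, mul_pos hU (hp0.trans_le hle)]

theorem bprime_iff_one_mod_six (p : ℕ) (hp : p.Prime) (hp3 : p ≠ 3) :
    ((∃ a b : ℕ, p = a^2 + a*b + b^2) ↔ p % 6 = 1) ∧
    (∀ a b c d : ℕ, b ≤ a → d ≤ c →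
      p = a^2 + a*b + b^2 → p = c^2 + c*d + d^2 → a = c ∧ b = d) := by
  refine ⟨⟨?_, hp.exists_eq_sq_add_mul_add_sq⟩, ?_⟩
  · rintro ⟨a, b, h⟩
    exact hp.mod_six_eq_one_of_eq_sq_add_mul_add_sq hp3 h
  · intro a b c d hba hdc h₁ h₂
    exact hp.sq_add_mul_add_sq_unique hp3 hba hdc h₁ h₂
end

section
/- A B-prime has a unique B-representation: if p is prime and p = a² + ab + b² = c² + cd + d² with a, b, c, d nonnegative integers, a ≥ b, and c ≥ d, then a = c and b = d. -/
/-- For a fixed second entry, the form `a² + ab + b²` determines its nonnegative first entry. -/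
lemma eq_of_sq_add_mul_add_sq_eq {a c b : ℤ} (ha : 0 ≤ a) (hc : 0 ≤ c) (hb : 0 ≤ b)
    (h : a ^ 2 + a * b + b ^ 2 = c ^ 2 + c * b + b ^ 2) : a = c := by
  have hmul : (a - c) * (a + c + b) = 0 := by linear_combination h
  rcases mul_eq_zero.1 hmul with h | h <;> omega

/-- If `z² + zx + x² = p²` with `z > 0` and `x ≥ 0`, then `x < p`, so `p ∣ x` forces `x = 0`. -/
lemma eq_zero_of_dvd_of_sq_add_mul_add_sq_eq_sq {p z x : ℤ} (hp : 0 < p) (hz : 0 < z)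
    (hx : 0 ≤ x) (h : z ^ 2 + z * x + x ^ 2 = p ^ 2) (hdvd : p ∣ x) : x = 0 := by
  refine Int.eq_zero_of_dvd_of_nonneg_of_lt hx ?_ hdvd
  exact lt_of_pow_lt_pow_left₀ 2 hp.le (by nlinarith [mul_nonneg hz.le hx])

theorem bprime_unique_rep (p a b c d : ℕ) (hp : p.Prime) (hab : b ≤ a) (hcd : d ≤ c)
    (h1 : p = a^2 + a*b + b^2) (h2 : p = c^2 + c*d + d^2) : a = c ∧ b = d := by
  have hp0 : 0 < p := hp.pos
  have ha : 0 < a := by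
    rcases Nat.eq_zero_or_pos a with rfl | h
    · obtain rfl : b = 0 := by omega
      simp at h1; omega
    · exact h
  have hc : 0 < c := by
    rcases Nat.eq_zero_or_pos c with rfl | h
    · obtain rfl : d = 0 := by omega
      simp at h2; omega
    · exact h
  have hpZ : Prime (p : ℤ) := Nat.prime_iff_prime_int.1 hp
  zify at h1 h2 hp0 ha hc hab hcd ⊢
  generalize (p : ℤ) = P at *
  have hb : (0 : ℤ) ≤ b := b.cast_nonneg
  have hd : (0 : ℤ) ≤ d := d.cast_nonneg
  generalize (a : ℤ) = a, (b : ℤ) = b, (c : ℤ) = c, (d : ℤ) = d at *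
  have hac : 0 < a * c := mul_pos ha hc
  have had : 0 ≤ a * d := mul_nonneg ha.le hd
  have hbc : 0 ≤ b * c := mul_nonneg hb hc.le
  have hbd : 0 ≤ b * d := mul_nonneg hb hd
  have of_eq : b = d → a = c ∧ b = d := by
    rintro rfl
    exact ⟨eq_of_sq_add_mul_add_sq_eq ha.le hc.le hb (h1.symm.trans h2), rfl⟩
  have hdvd : P ∣ (a * d - b * c) * (a * d + b * c + b * d) :=
    ⟨d ^ 2 - b ^ 2, by linear_combination (-d ^ 2) * h1 + b ^ 2 * h2⟩
  rcases hpZ.dvd_or_dvd hdvd with h | h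
  · have hX : a * d - b * c = 0 := by
      rcases le_total 0 (a * d - b * c) with hs | hs
      · refine eq_zero_of_dvd_of_sq_add_mul_add_sq_eq_sq hp0
          (z := a * c + b * d + b * c) (by linarith) hs ?_ h
        linear_combination (-P) * h1 - (a ^ 2 + a * b + b ^ 2) * h2
      · have := eq_zero_of_dvd_of_sq_add_mul_add_sq_eq_sq hp0
          (z := a * c + b * d + a * d) (x := -(a * d - b * c)) (by linarith) (by linarith)
          (by linear_combination (-P) * h1 - (a ^ 2 + a * b + b ^ 2) * h2) (dvd_neg.2 h)
        linarith
    apply of_eq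
    have hsq : P * (b ^ 2 - d ^ 2) = 0 := by
      linear_combination (-(a * d + b * c + b * d)) * hX - d ^ 2 * h1 + b ^ 2 * h2
    have := (mul_eq_zero.1 hsq).resolve_left hp0.ne'
    exact (sq_eq_sq₀ hb hd).1 (by linarith)
  · have hZ : b * d ≤ a * c := mul_le_mul hab hcd hd ha.le
    rcases hZ.eq_or_lt with hZ | hZ
    · obtain rfl : a = b := by nlinarith
      obtain rfl : c = d := by nlinarith
      have : a = c := (sq_eq_sq₀ ha.le hc.le).1 (by linarith)
      exact ⟨this, this⟩
    · have hY := eq_zero_of_dvd_of_sq_add_mul_add_sq_eq_sq hp0 (z := a * c - b * d)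
        (by linarith) (by linarith)
        (by linear_combination (-P) * h1 - (a ^ 2 + a * b + b ^ 2) * h2) h
      have hb0 : b = 0 := by
        have : b * c = 0 := by linarith
        exact (mul_eq_zero.1 this).resolve_right hc.ne'
      have hd0 : d = 0 := by
        have : a * d = 0 := by linarith
        exact (mul_eq_zero.1 this).resolve_left ha.ne'
      exact of_eq (hb0.trans hd0.symm)
end

section
/- If a B-number n is divisible by a B-prime p, then the quotient n/p is a B-number: if n = a² + ab + b² and p = c² + cd + d² is prime with a, b, c, d nonnegative integers and p divides n, then n/p = r² + rw + w² for some nonnegative integers r and w. -/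
/-- A value of the form `x² + xy + y²` at integers is also attained at natural numbers. -/
theorem exists_nat_sq_add_mul_add_sq (x y : ℤ) :
    ∃ r w : ℕ, x ^ 2 + x * y + y ^ 2 = (r : ℤ) ^ 2 + r * w + w ^ 2 := by
  suffices h : ∃ r w : ℤ, 0 ≤ r ∧ 0 ≤ w ∧ x ^ 2 + x * y + y ^ 2 = r ^ 2 + r * w + w ^ 2 by
    obtain ⟨r, w, hr, hw, h⟩ := h
    lift r to ℕ using hr
    lift w to ℕ using hw
    exact ⟨r, w, h⟩
  rcases le_total 0 x with hx | hx <;> rcases le_total 0 y with hy | hy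
  · exact ⟨x, y, hx, hy, rfl⟩
  · rcases le_total 0 (x + y) with h | h
    · exact ⟨x + y, -y, h, by lia, by ring⟩
    · exact ⟨x, -(x + y), hx, by lia, by ring⟩
  · rcases le_total 0 (x + y) with h | h
    · exact ⟨x + y, -x, h, by lia, by ring⟩
    · exact ⟨y, -(x + y), hy, by lia, by ring⟩
  · exact ⟨-x, -y, by lia, by lia, by ring⟩

/-- If `x² + xy + y² = pn` with `p` a prime dividing `y`, then `n / p` is again
a value of the form. -/
theorem Prime.exists_eq_mul_sq_add_mul_add_sq {p n x y : ℤ} (hp : Prime p)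
    (hy : p ∣ y) (h : x ^ 2 + x * y + y ^ 2 = p * n) :
    ∃ r w : ℤ, n = p * (r ^ 2 + r * w + w ^ 2) := by
  have hx : p ∣ x := by
    apply hp.dvd_of_dvd_pow (n := 2)
    rw [show x ^ 2 = p * n - y * (x + y) by linear_combination h]
    exact (dvd_mul_right p n).sub (hy.mul_right _)
  obtain ⟨r, rfl⟩ := hx
  obtain ⟨w, rfl⟩ := hy
  exact ⟨r, w, mul_left_cancel₀ hp.ne_zero (by linear_combination -h)⟩

theorem bnum_div_bprime (n p a b c d : ℕ) (hn : n = a^2 + a*b + b^2)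
    (hpB : p = c^2 + c*d + d^2) (hp : p.Prime) (hdvd : p ∣ n) :
    ∃ r w : ℕ, n / p = r^2 + r*w + w^2 := by
  have hpZ : Prime (p : ℤ) := Nat.prime_iff_prime_int.mp hp
  have hdvdZ : (p : ℤ) ∣ n := Int.natCast_dvd_natCast.mpr hdvd
  have hnZ : (n : ℤ) = a ^ 2 + a * b + b ^ 2 := by exact_mod_cast hn
  have hpBZ : (p : ℤ) = c ^ 2 + c * d + d ^ 2 := by exact_mod_cast hpB
  have hmul : (p : ℤ) ∣ (b * c - a * d) * (a * c + a * d + b * c) := by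
    rw [show ((b : ℤ) * c - a * d) * (a * c + a * d + b * c) = n * c ^ 2 - p * a ^ 2 by
      rw [hnZ, hpBZ]; ring]
    exact (hdvdZ.mul_right _).sub (dvd_mul_right _ _)
  have key : ∃ r w : ℤ, (n : ℤ) = p * (r ^ 2 + r * w + w ^ 2) := by
    rcases hpZ.dvd_or_dvd hmul with h | h
    · exact hpZ.exists_eq_mul_sq_add_mul_add_sq (x := a * c + a * d + b * d) h
        (by rw [hnZ, hpBZ]; ring)
    · exact hpZ.exists_eq_mul_sq_add_mul_add_sq (x := b * d - a * c) h
        (by rw [hnZ, hpBZ]; ring)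
  obtain ⟨x, y, hxy⟩ := key
  obtain ⟨r, w, hrw⟩ := exists_nat_sq_add_mul_add_sq x y
  rw [hrw] at hxy
  exact ⟨r, w, Nat.div_eq_of_eq_mul_right hp.pos (by exact_mod_cast hxy)⟩
end

section
/- If a B-number n has a positive divisor m that is not a B-number, with n = m·k, then k has at least one prime factor that is not a B-prime. -/
theorem exists_nat_of_int_sq_add_mul_add_sq {m : ℕ} {x y : ℤ}
    (h : (m : ℤ) = x ^ 2 + x * y + y ^ 2) : ∃ a b : ℕ, m = a ^ 2 + a * b + b ^ 2 := by
  suffices H : ∃ a b : ℤ, 0 ≤ a ∧ 0 ≤ b ∧ (m : ℤ) = a ^ 2 + a * b + b ^ 2 by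
    obtain ⟨a, b, ha, hb, hab⟩ := H
    lift a to ℕ using ha
    lift b to ℕ using hb
    exact ⟨a, b, by exact_mod_cast hab⟩
  rcases le_total 0 x with hx | hx <;> rcases le_total 0 y with hy | hy <;>
    rcases le_total 0 (x + y) with hs | hs
  · exact ⟨x, y, hx, hy, h⟩
  · exact ⟨x, y, hx, hy, h⟩
  · exact ⟨x + y, -y, hs, by omega, by rw [h]; ring⟩
  · exact ⟨x, -(x + y), hx, by omega, by rw [h]; ring⟩
  · exact ⟨x + y, -x, hs, by omega, by rw [h]; ring⟩
  · exact ⟨y, -(x + y), hy, by omega, by rw [h]; ring⟩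
  · exact ⟨-x, -y, by omega, by omega, by rw [h]; ring⟩
  · exact ⟨-x, -y, by omega, by omega, by rw [h]; ring⟩

theorem exists_sq_add_mul_add_sq_of_prime_dvd {p m x y : ℤ} (hp : Prime p)
    (h : p * p * m = x ^ 2 + x * y + y ^ 2) (hy : p ∣ y) :
    ∃ u v : ℤ, m = u ^ 2 + u * v + v ^ 2 := by
  obtain ⟨v, rfl⟩ := hy
  have hx : p ∣ x := hp.dvd_of_dvd_pow (n := 2) ⟨p * m - x * v - p * v ^ 2, by linear_combination -h⟩
  obtain ⟨u, rfl⟩ := hx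
  refine ⟨u, v, mul_left_cancel₀ (mul_ne_zero hp.ne_zero hp.ne_zero) ?_⟩
  linear_combination h

theorem exists_sq_add_mul_add_sq_of_prime_mul {p m : ℕ} (hp : p.Prime)
    (hpB : ∃ a b : ℕ, p = a ^ 2 + a * b + b ^ 2)
    (h : ∃ a b : ℕ, p * m = a ^ 2 + a * b + b ^ 2) :
    ∃ a b : ℕ, m = a ^ 2 + a * b + b ^ 2 := by
  obtain ⟨c, d, hcd⟩ := hpB
  obtain ⟨a, b, hab⟩ := h
  have hp' : Prime (p : ℤ) := Nat.prime_iff_prime_int.mp hp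
  zify at hcd hab
  have hdvd : (p : ℤ) ∣ (b * c - a * d) * (a * d + b * c + b * d) :=
    ⟨b ^ 2 - m * d ^ 2, by linear_combination (-b ^ 2 : ℤ) * hcd + (d ^ 2 : ℤ) * hab⟩
  suffices H : ∃ u v : ℤ, (m : ℤ) = u ^ 2 + u * v + v ^ 2 by
    obtain ⟨u, v, huv⟩ := H
    exact exists_nat_of_int_sq_add_mul_add_sq huv
  rcases hp'.dvd_or_dvd hdvd with hy | hy
  · refine exists_sq_add_mul_add_sq_of_prime_dvd (x := a * c + a * d + b * d) hp' ?_ hy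
    linear_combination (p * m : ℤ) * hcd + (c ^ 2 + c * d + d ^ 2 : ℤ) * hab
  · refine exists_sq_add_mul_add_sq_of_prime_dvd (x := a * c - b * d) hp' ?_ hy
    linear_combination (p * m : ℤ) * hcd + (c ^ 2 + c * d + d ^ 2 : ℤ) * hab

theorem not_exists_two_eq_sq_add_mul_add_sq : ¬ ∃ a b : ℕ, 2 = a ^ 2 + a * b + b ^ 2 := by
  rintro ⟨a, b, h⟩
  have ha : a < 2 := by nlinarith
  have hb : b < 2 := by nlinarith
  interval_cases a <;> interval_cases b <;> omega

theorem bnum_nonbnum_factor (n m k : ℕ) (hn : ∃ a b : ℕ, n = a^2 + a*b + b^2)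
    (hm : 0 < m) (hnk : n = m * k) (hmB : ¬ ∃ a b : ℕ, m = a^2 + a*b + b^2) :
    ∃ q : ℕ, q.Prime ∧ q ∣ k ∧ ¬ ∃ a b : ℕ, q = a^2 + a*b + b^2 := by
  subst hnk
  induction k using induction_on_primes with
  | zero => exact ⟨2, Nat.prime_two, dvd_zero 2, not_exists_two_eq_sq_add_mul_add_sq⟩
  | one => exact absurd (by simpa using hn) hmB
  | prime_mul p k hp ih =>
    by_cases hpB : ∃ a b : ℕ, p = a ^ 2 + a * b + b ^ 2
    · rw [mul_left_comm] at hn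
      obtain ⟨q, hq, hqk, hqB⟩ := ih (exists_sq_add_mul_add_sq_of_prime_mul hp hpB hn)
      exact ⟨q, hq, hqk.mul_left p, hqB⟩
    · exact ⟨p, hp, dvd_mul_right p k, hpB⟩
end

section
/- If n = a² + ab + b² where a and b are nonnegative integers with gcd(a, b) = 1, then every positive divisor of n is a B-number. -/
/-- A binary quadratic form `m x² + (2t+1) x y + k y²` of discriminant `-3` with `m > 0` is obtained
from `x² + x y + y²` by an integral linear substitution. -/
theorem exists_substitution_of_mul_eq (m : ℕ) (hm : 0 < m) (t k : ℤ)
    (h : (m : ℤ) * k = t ^ 2 + t + 1) :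
    ∃ p q r s : ℤ, (m : ℤ) = p ^ 2 + p * q + q ^ 2 ∧ k = r ^ 2 + r * s + s ^ 2 ∧
      2 * t + 1 = 2 * p * r + p * s + q * r + 2 * q * s := by
  induction m using Nat.strong_induction_on generalizing t k with
  | _ m ih =>
    obtain rfl | hm1 : m = 1 ∨ 1 < m := by omega
    · exact ⟨1, 0, t, 1, by norm_num, by push_cast at h; linarith, by ring⟩
    have hmZ : (1 : ℤ) < m := by exact_mod_cast hm1
    obtain ⟨j, hlo, hhi⟩ : ∃ j : ℤ, -(m : ℤ) ≤ 2 * (t + m * j) + 1 ∧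
        2 * (t + m * j) + 1 ≤ m := by
      refine ⟨-((t + m / 2) / m), ?_⟩
      have h1 := Int.mul_ediv_add_emod (t + m / 2) m
      have h2 := Int.emod_nonneg (t + m / 2) (by omega : (m : ℤ) ≠ 0)
      have h3 := Int.emod_lt_of_pos (t + m / 2) (by omega : (0 : ℤ) < m)
      rw [mul_neg]
      constructor <;> omega
    obtain ⟨t', ht'⟩ : ∃ t', t' = t + m * j := ⟨_, rfl⟩
    obtain ⟨k', hk'⟩ : ∃ k', k' = k + (2 * t + 1) * j + m * j ^ 2 := ⟨_, rfl⟩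
    rw [← ht'] at hlo hhi
    have h' : (m : ℤ) * k' = t' ^ 2 + t' + 1 := by
      rw [ht', hk']; linear_combination h
    have hkpos : 0 < k' := by
      by_contra! hk
      nlinarith [sq_nonneg (2 * t' + 1)]
    have hklt : k' < m := by
      by_contra! hk
      nlinarith
    lift k' to ℕ using hkpos.le
    obtain ⟨p, q, r, s, h1, h2, h3⟩ := ih k' (by exact_mod_cast hklt) (by exact_mod_cast hkpos)
      t' m (by rw [mul_comm]; exact h')
    refine ⟨r, s, p - j * r, q - j * s, h2, ?_, ?_⟩
    · linear_combination -hk' + h1 - j * h3 + 2 * j * ht' + j ^ 2 * h2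
    · linear_combination h3 - 2 * ht' - 2 * j * h2

/-- The nonnegative values of `x² + x y + y²` on `ℤ` are already taken on `ℕ`. -/
theorem exists_nat_eq_of_int_eq (m : ℕ) (x y : ℤ) (h : (m : ℤ) = x ^ 2 + x * y + y ^ 2) :
    ∃ c d : ℕ, m = c ^ 2 + c * d + d ^ 2 := by
  have of_nonneg : ∀ u v : ℤ, 0 ≤ u → 0 ≤ v → (m : ℤ) = u ^ 2 + u * v + v ^ 2 →
      ∃ c d : ℕ, m = c ^ 2 + c * d + d ^ 2 := by
    intro u v hu hv huv
    lift u to ℕ using hu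
    lift v to ℕ using hv
    exact ⟨u, v, by exact_mod_cast huv⟩
  rcases le_total 0 x with hx | hx <;> rcases le_total 0 y with hy | hy <;>
    rcases le_total 0 (x + y) with hxy | hxy
  · exact of_nonneg x y hx hy h
  · exact of_nonneg x y hx hy h
  · exact of_nonneg (x + y) (-y) hxy (by omega) (by linear_combination h)
  · exact of_nonneg x (-(x + y)) hx (by omega) (by linear_combination h)
  · exact of_nonneg (x + y) (-x) hxy (by omega) (by linear_combination h)
  · exact of_nonneg y (-(x + y)) hy (by omega) (by linear_combination h)
  all_goals exact of_nonneg (-x) (-y) (by omega) (by omega) (by linear_combination h)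

theorem factor_of_bnum (n a b : ℕ) (hn : n = a^2 + a*b + b^2) (hab : Nat.gcd a b = 1)
    (m : ℕ) (hm : 0 < m) (hdvd : m ∣ n) : ∃ c d : ℕ, m = c^2 + c*d + d^2 := by
  have hab' : IsCoprime (a : ℤ) b := Nat.isCoprime_iff_coprime.mpr hab
  obtain ⟨w, hw⟩ := hdvd
  have hw' : (m : ℤ) * w = a ^ 2 + a * b + b ^ 2 := by exact_mod_cast hw.symm.trans hn
  have hbm : IsCoprime (b : ℤ) m := by
    have hbn : IsCoprime (b : ℤ) (m * w) := by
      have := (hab'.symm.pow_right (n := 2)).add_mul_left_right ((a : ℤ) + b)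
      rwa [hw', show (a : ℤ) ^ 2 + a * b + b ^ 2 = a ^ 2 + b * (a + b) by ring]
    exact hbn.of_mul_right_left
  obtain ⟨u, v, huv⟩ := hbm
  obtain ⟨p, q, -, -, hpq, -⟩ := exists_substitution_of_mul_eq m hm (a * u)
    (u ^ 2 * w + a * u * v + v * (1 + u * b))
    (by linear_combination u ^ 2 * hw' + (a * u + 1 + u * b) * huv)
  exact exists_nat_eq_of_int_eq m p q hpq
end

section
/- If m and k are positive integers and m·k² is a B-number, then m is a B-number. -/
/-- Division with remainder of absolute value at most half the divisor. -/
lemma Int.exists_two_mul_abs_sub_mul_le (a : ℤ) {t : ℤ} (ht : 0 < t) :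
    ∃ u : ℤ, 2 * |a - t * u| ≤ t := by
  refine ⟨(2 * a + t) / (2 * t), ?_⟩
  have h₁ := Int.mul_ediv_add_emod (2 * a + t) (2 * t)
  have h₂ := Int.emod_nonneg (2 * a + t) (show 2 * t ≠ 0 by omega)
  have h₃ := Int.emod_lt_of_pos (2 * a + t) (show 0 < 2 * t by omega)
  rcases abs_cases (a - t * ((2 * a + t) / (2 * t))) with h | h <;> nlinarith

/-- The Davenport–Cassels descent for the form `x² + xy + y²`. -/
lemma exists_int_eq_of_mul_sq_eq (m : ℤ) (t : ℕ) (ht : 0 < t) (a b : ℤ)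
    (h : m * (t : ℤ) ^ 2 = a ^ 2 + a * b + b ^ 2) :
    ∃ u v : ℤ, m = u ^ 2 + u * v + v ^ 2 := by
  induction t using Nat.strong_induction_on generalizing a b with
  | _ t ih =>
    have ht' : (0 : ℤ) < t := by exact_mod_cast ht
    obtain ⟨u, hu⟩ := Int.exists_two_mul_abs_sub_mul_le a ht'
    obtain ⟨v, hv⟩ := Int.exists_two_mul_abs_sub_mul_le b ht'
    obtain ⟨r, hr⟩ : ∃ r, r = a - t * u := ⟨_, rfl⟩
    obtain ⟨s, hs⟩ : ∃ s, s = b - t * v := ⟨_, rfl⟩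
    rw [← hr] at hu
    rw [← hs] at hv
    obtain ⟨c, hc⟩ : ∃ c, c = u ^ 2 + u * v + v ^ 2 - m := ⟨_, rfl⟩
    obtain ⟨d, hd⟩ : ∃ d, d = 2 * m * t - (2 * a * u + a * v + b * u + 2 * b * v) := ⟨_, rfl⟩
    have hnorm : t * (c * t + d) = r ^ 2 + r * s + s ^ 2 := by
      subst hr hs hc hd
      linear_combination h
    have hlt : r ^ 2 + r * s + s ^ 2 < (t : ℤ) ^ 2 := by
      have hr2 : (2 * r) ^ 2 ≤ (t : ℤ) ^ 2 :=
        sq_le_sq.mpr (by simpa [abs_mul] using hu)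
      have hs2 : (2 * s) ^ 2 ≤ (t : ℤ) ^ 2 :=
        sq_le_sq.mpr (by simpa [abs_mul] using hv)
      nlinarith [sq_nonneg (r - s)]
    rcases eq_or_ne (r ^ 2 + r * s + s ^ 2) 0 with h0 | h0
    · have hr0 : r = 0 := by
        rw [← sq_eq_zero_iff]
        nlinarith [sq_nonneg (r + 2 * s), sq_nonneg r]
      have hs0 : s = 0 := by simpa [hr0] using h0
      refine ⟨u, v, mul_right_cancel₀ (pow_ne_zero 2 ht'.ne') (h.trans ?_)⟩
      rw [show a = t * u by omega, show b = t * v by omega]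
      ring
    · have hpos : 0 < r ^ 2 + r * s + s ^ 2 := by
        refine lt_of_le_of_ne ?_ h0.symm
        nlinarith [sq_nonneg (r + s), sq_nonneg r, sq_nonneg s]
      have hpos' : 0 < c * t + d := by
        rw [← hnorm] at hpos
        exact pos_of_mul_pos_right hpos ht'.le
      have hlt' : c * t + d < t := by nlinarith
      refine ih (c * t + d).toNat (by omega) (by omega) (c * a + d * u) (c * b + d * v) ?_
      rw [Int.toNat_of_nonneg hpos'.le]
      subst hc hd
      linear_combination (u ^ 2 + u * v + v ^ 2 - m) ^ 2 * h

/-- An integer represented by `x² + xy + y²` is represented with nonnegative arguments. -/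
lemma exists_nat_eq_of_int_eq_s18 (m : ℕ) (u v : ℤ) (h : (m : ℤ) = u ^ 2 + u * v + v ^ 2) :
    ∃ a b : ℕ, m = a ^ 2 + a * b + b ^ 2 := by
  suffices ∃ x y : ℤ, 0 ≤ x ∧ 0 ≤ y ∧ (m : ℤ) = x ^ 2 + x * y + y ^ 2 by
    obtain ⟨x, y, hx, hy, hxy⟩ := this
    lift x to ℕ using hx
    lift y to ℕ using hy
    exact ⟨x, y, by exact_mod_cast hxy⟩
  rcases le_total 0 u with hu | hu <;> rcases le_total 0 v with hv | hv
  · exact ⟨u, v, hu, hv, h⟩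
  · rcases le_total 0 (u + v) with huv | huv
    · exact ⟨u + v, -v, huv, by omega, by rw [h]; ring⟩
    · exact ⟨-(u + v), u, by omega, hu, by rw [h]; ring⟩
  · rcases le_total 0 (u + v) with huv | huv
    · exact ⟨u + v, -u, huv, by omega, by rw [h]; ring⟩
    · exact ⟨-(u + v), v, by omega, hv, by rw [h]; ring⟩
  · exact ⟨-u, -v, by omega, by omega, by rw [h]; ring⟩

theorem bnum_div_square (m k : ℕ) (hm : 0 < m) (hk : 0 < k)
    (h : ∃ a b : ℕ, m * k^2 = a^2 + a*b + b^2) :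
    ∃ a b : ℕ, m = a^2 + a*b + b^2 := by
  obtain ⟨a, b, hab⟩ := h
  obtain ⟨u, v, huv⟩ := exists_int_eq_of_mul_sq_eq m k hk a b (by exact_mod_cast hab)
  exact exists_nat_eq_of_int_eq_s18 m u v huv
end

section
/- If a positive integer n can be written as n = α² + αβ + β² with α and β nonnegative rational numbers, then n is a B-number, i.e., n = a² + ab + b² for some nonnegative integers a and b. -/
theorem Int.exists_two_mul_abs_sub_mul_le_s19 (x : ℤ) {d : ℤ} (hd : 0 < d) :
    ∃ y : ℤ, 2 * |x - d * y| ≤ d := by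
  refine ⟨(2 * x + d) / (2 * d), ?_⟩
  have h₁ := Int.mul_ediv_add_emod (2 * x + d) (2 * d)
  have h₂ := Int.emod_nonneg (2 * x + d) (b := 2 * d) (by omega)
  have h₃ := Int.emod_lt_of_pos (2 * x + d) (b := 2 * d) (by omega)
  have h₄ : |x - d * ((2 * x + d) / (2 * d))| * 2 = |2 * (x - d * ((2 * x + d) / (2 * d)))| := by
    rw [abs_mul, abs_two, mul_comm]
  rw [mul_comm, h₄, abs_le]
  constructor <;> linarith

/-- The Aubry–Davenport–Cassels descent for the form `x ^ 2 + x * y + y ^ 2`. -/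
theorem Int.exists_eq_sq_add_mul_add_sq_of_mul_sq (n : ℤ) (d : ℕ) (hd : 0 < d) (x y : ℤ)
    (h : n * (d : ℤ) ^ 2 = x ^ 2 + x * y + y ^ 2) :
    ∃ a b : ℤ, n = a ^ 2 + a * b + b ^ 2 := by
  induction d using Nat.strong_induction_on generalizing x y with
  | _ d ih =>
    have hd' : (0 : ℤ) < d := by exact_mod_cast hd
    obtain ⟨u, hu⟩ := Int.exists_two_mul_abs_sub_mul_le_s19 x hd'
    obtain ⟨v, hv⟩ := Int.exists_two_mul_abs_sub_mul_le_s19 y hd'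
    obtain ⟨r, hr⟩ : ∃ r, r = x - d * u := ⟨_, rfl⟩
    obtain ⟨s, hs⟩ : ∃ s, s = y - d * v := ⟨_, rfl⟩
    rw [← hr] at hu
    rw [← hs] at hv
    obtain ⟨b, hb⟩ : ∃ b, b = 2 * n * d - (2 * x * u + x * v + y * u + 2 * y * v) := ⟨_, rfl⟩
    obtain ⟨a, ha⟩ : ∃ a, a = u ^ 2 + u * v + v ^ 2 - n := ⟨_, rfl⟩
    obtain ⟨e, he⟩ : ∃ e, e = a * d + b := ⟨_, rfl⟩
    have hde : d * e = r ^ 2 + r * s + s ^ 2 := by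
      subst hr hs he ha hb
      linear_combination h
    have hr2 : 4 * r ^ 2 ≤ (d : ℤ) ^ 2 := by
      nlinarith [abs_nonneg r, sq_abs r]
    have hs2 : 4 * s ^ 2 ≤ (d : ℤ) ^ 2 := by
      nlinarith [abs_nonneg s, sq_abs s]
    have he_lt : e < d := by
      nlinarith [sq_nonneg (r - s)]
    have he_nonneg : 0 ≤ e := by
      nlinarith [sq_nonneg (r + s), sq_nonneg r, sq_nonneg s]
    rcases he_nonneg.eq_or_lt with he0 | he_pos
    · rw [← he0, mul_zero] at hde
      have hr0 : r = 0 := by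
        nlinarith [sq_nonneg (r + s), sq_nonneg r, sq_nonneg s]
      have hs0 : s = 0 := by
        nlinarith [sq_nonneg (r + s), sq_nonneg r, sq_nonneg s]
      refine ⟨u, v, mul_right_cancel₀ (pow_ne_zero 2 hd'.ne') ?_⟩
      rw [h, sub_eq_zero.mp (hr.symm.trans hr0), sub_eq_zero.mp (hs.symm.trans hs0)]
      ring
    · lift e to ℕ using he_nonneg
      refine ih e (by exact_mod_cast he_lt) (by exact_mod_cast he_pos)
        (a * x + b * u) (a * y + b * v) ?_
      rw [he]
      have hB : 2 * x * u + x * v + y * u + 2 * y * v = 2 * n * d - b := by linarith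
      have hQ : u ^ 2 + u * v + v ^ 2 = n + a := by linarith
      linear_combination a ^ 2 * h - a * b * hB - b ^ 2 * hQ

theorem Int.exists_nat_sq_add_mul_add_sq (a b : ℤ) :
    ∃ c d : ℕ, a ^ 2 + a * b + b ^ 2 = (c : ℤ) ^ 2 + c * d + d ^ 2 := by
  have of_nonneg {x y : ℤ} (hx : 0 ≤ x) (hy : 0 ≤ y)
      (h : a ^ 2 + a * b + b ^ 2 = x ^ 2 + x * y + y ^ 2) :
      ∃ c d : ℕ, a ^ 2 + a * b + b ^ 2 = (c : ℤ) ^ 2 + c * d + d ^ 2 := by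
    lift x to ℕ using hx
    lift y to ℕ using hy
    exact ⟨x, y, h⟩
  rcases le_total 0 a with ha | ha <;> rcases le_total 0 b with hb | hb <;>
    rcases le_total 0 (a + b) with hab | hab
  · exact of_nonneg ha hb rfl
  · exact of_nonneg ha hb rfl
  · exact of_nonneg hab (neg_nonneg.mpr hb) (by ring)
  · exact of_nonneg (neg_nonneg.mpr hab) ha (by ring)
  · exact of_nonneg hab (neg_nonneg.mpr ha) (by ring)
  · exact of_nonneg (neg_nonneg.mpr hab) hb (by ring)
  all_goals exact of_nonneg (neg_nonneg.mpr ha) (neg_nonneg.mpr hb) (by ring)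

theorem rational_bnum (n : ℕ) (hn : 0 < n) (α β : ℚ) (hα : 0 ≤ α) (hβ : 0 ≤ β)
    (h : (n : ℚ) = α^2 + α*β + β^2) :
    ∃ a b : ℕ, n = a^2 + a*b + b^2 := by
  have hint : (n : ℤ) * ((α.den * β.den : ℕ) : ℤ) ^ 2 = (α.num * β.den) ^ 2 +
      α.num * β.den * (β.num * α.den) + (β.num * α.den) ^ 2 := by
    have h₁ := Rat.mul_den_eq_num α
    have h₂ := Rat.mul_den_eq_num β
    have : (n : ℚ) * (α.den * β.den) ^ 2 = (α.num * β.den) ^ 2 +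
        α.num * β.den * (β.num * α.den) + (β.num * α.den) ^ 2 := by
      rw [h, ← h₁, ← h₂]
      ring
    exact_mod_cast this
  obtain ⟨a, b, hab⟩ := Int.exists_eq_sq_add_mul_add_sq_of_mul_sq n _
    (Nat.mul_pos α.den_pos β.den_pos) _ _ hint
  obtain ⟨c, d, hcd⟩ := Int.exists_nat_sq_add_mul_add_sq a b
  exact ⟨c, d, by exact_mod_cast hab.trans hcd⟩
end
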